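/- Fix integers m ≥ 2 and k ≥ 2. For every i ∈ {0,1,…,m−1}, r_ℳ(i,m,k) = r_ℳ(gcd(i,m) mod m, m, k), where gcd(0,m) is understood as m (so that gcd(0,m) mod m = 0). -/

import Mathlib

/-- `pM m k n` is the number of restricted `m`-ary partitions of `n` with parts
`1, m, m^2, …, m^(k-1)`. -/
noncomputable def pM (m k n : ℕ) : ℕ :=
  Nat.card {x : Fin k → ℕ // ∑ i : Fin k, x i * m ^ (i : ℕ) = n}

/-- `rM i m k = #{n ∈ {0,…,m^k - 1} : p_ℳ(n,k) ≡ i (mod m)}`. -/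
noncomputable def rM (i m k : ℕ) : ℕ :=
  ((Finset.range (m ^ k)).filter (fun n : ℕ => pM m k n % m = i)).card

theorem finite_restricted_partitions {m : ℕ} (hm : 0 < m) (k n : ℕ) :
    Finite {x : Fin k → ℕ // ∑ i : Fin k, x i * m ^ (i : ℕ) = n} := by
  refine ((Set.finite_Iic (fun _ : Fin k => n)).subset fun x hx i => ?_).to_subtype
  calc x i ≤ x i * m ^ (i : ℕ) := Nat.le_mul_of_pos_right _ (by positivity)
    _ ≤ ∑ j : Fin k, x j * m ^ (j : ℕ) :=
      Finset.single_le_sum (f := fun j : Fin k => x j * m ^ (j : ℕ))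
        (fun _ _ => Nat.zero_le _) (Finset.mem_univ i)
    _ = n := hx

theorem sum_mul_pow_succ (m k : ℕ) (x : Fin (k + 1) → ℕ) :
    ∑ i : Fin (k + 1), x i * m ^ (i : ℕ) =
      x 0 + m * ∑ i : Fin k, x i.succ * m ^ (i : ℕ) := by
  rw [Fin.sum_univ_succ, Finset.mul_sum]
  simp only [Fin.val_zero, pow_zero, mul_one, Fin.val_succ, pow_succ]
  congr 1
  exact Finset.sum_congr rfl fun _ _ => by ring

/-- Splitting off the parts equal to `1`. -/
def restrictedPartitionEquiv {m : ℕ} (hm : 0 < m) (k n : ℕ) :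
    {x : Fin (k + 1) → ℕ // ∑ i : Fin (k + 1), x i * m ^ (i : ℕ) = n} ≃
      Σ j : Fin (n / m + 1), {x : Fin k → ℕ // ∑ i : Fin k, x i * m ^ (i : ℕ) = j} where
  toFun x := ⟨⟨∑ i : Fin k, x.1 i.succ * m ^ (i : ℕ), by
    have h := x.2
    rw [sum_mul_pow_succ] at h
    rw [Nat.lt_succ_iff, Nat.le_div_iff_mul_le hm, mul_comm]
    omega⟩, fun i => x.1 i.succ, rfl⟩
  invFun y := ⟨Fin.cons (n - m * y.1) y.2.1, by
    have h : (y.1 : ℕ) ≤ n / m := Nat.lt_succ_iff.mp y.1.2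
    rw [Nat.le_div_iff_mul_le hm, mul_comm] at h
    rw [sum_mul_pow_succ]
    simp only [Fin.cons_zero, Fin.cons_succ, y.2.2]
    omega⟩
  left_inv x := by
    have h := x.2
    rw [sum_mul_pow_succ] at h
    ext i
    refine Fin.cases ?_ (fun i => ?_) i
    · simp only [Fin.cons_zero]
      omega
    · simp
  right_inv := by
    rintro ⟨⟨j, hj⟩, x, hx⟩
    change _ = j at hx
    subst hx
    rfl

theorem pM_succ {m : ℕ} (hm : 0 < m) (k n : ℕ) :
    pM m (k + 1) n = ∑ j ∈ Finset.range (n / m + 1), pM m k j := by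
  have := finite_restricted_partitions hm k
  rw [pM, Nat.card_congr (restrictedPartitionEquiv hm k n), Nat.card_sigma,
    ← Fin.sum_univ_eq_sum_range]
  rfl

theorem pM_zero (m n : ℕ) : pM m 0 n = if n = 0 then 1 else 0 := by
  split_ifs with h <;> simp [pM, h, eq_comm]

/-- Summing modulo `m` a function constant on blocks of length `m`. -/
theorem sum_range_div_cast (m : ℕ) (f : ℕ → ZMod m) (q : ℕ) :
    ∑ j ∈ Finset.range q, f (j / m) = q * f (q / m) := by
  induction q with
  | zero => simp
  | succ q ih =>
    rw [Finset.sum_range_succ, ih]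
    by_cases h : m ∣ q + 1
    · have h0 : ((q + 1 : ℕ) : ZMod m) = 0 := (ZMod.natCast_eq_zero_iff _ _).mpr h
      rw [h0]
      push_cast at h0
      linear_combination f (q / m) * h0
    · rw [Nat.succ_div_of_not_dvd h]
      push_cast
      ring

theorem pM_succ_mod {m : ℕ} (hm : 0 < m) (k n : ℕ) :
    (pM m (k + 2) n : ZMod m) = (n / m + 1 : ℕ) * pM m (k + 1) (n / m) := by
  have hdep (j : ℕ) : pM m (k + 1) j = pM m (k + 1) (m * (j / m)) := by
    rw [pM_succ hm, pM_succ hm, Nat.mul_div_cancel_left _ hm]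
  rw [pM_succ hm, hdep (n / m)]
  push_cast
  rw [Finset.sum_range_succ, Finset.sum_congr rfl fun j _ => by rw [hdep j],
    sum_range_div_cast m (fun j => (pM m (k + 1) (m * j) : ZMod m)), hdep (n / m)]
  ring

/-- Apply the affine map `b ↦ u (b + 1) - 1` to the digit of weight `m`. -/
def scaleDigit {m : ℕ} (u : ZMod m) (n : ℕ) : ℕ :=
  n % m + m * ((u * ((n / m : ℕ) + 1) - 1).val + m * (n / m / m))

theorem scaleDigit_div {m : ℕ} [NeZero m] (u : ZMod m) (n : ℕ) :
    scaleDigit u n / m = (u * ((n / m : ℕ) + 1) - 1).val + m * (n / m / m) := by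
  have hm := NeZero.pos m
  rw [scaleDigit, Nat.add_mul_div_left _ _ hm, Nat.div_eq_of_lt (Nat.mod_lt _ hm), zero_add]

theorem scaleDigit_div_div {m : ℕ} [NeZero m] (u : ZMod m) (n : ℕ) :
    scaleDigit u n / m / m = n / m / m := by
  rw [scaleDigit_div, Nat.add_mul_div_left _ _ (NeZero.pos m), Nat.div_eq_of_lt (ZMod.val_lt _),
    zero_add]

theorem cast_scaleDigit_div {m : ℕ} [NeZero m] (u : ZMod m) (n : ℕ) :
    ((scaleDigit u n / m : ℕ) : ZMod m) = u * ((n / m : ℕ) + 1) - 1 := by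
  rw [scaleDigit_div]
  simp

theorem scaleDigit_scaleDigit {m : ℕ} [NeZero m] {u v : ZMod m} (h : v * u = 1) (n : ℕ) :
    scaleDigit v (scaleDigit u n) = n := by
  have hmod : scaleDigit u n % m = n % m := by simp [scaleDigit]
  have hval : v * (u * ((n / m : ℕ) + 1) - 1 + 1) - 1 = ((n / m : ℕ) : ZMod m) := by
    linear_combination (((n / m : ℕ) : ZMod m) + 1) * h
  rw [scaleDigit, hmod, scaleDigit_div_div, cast_scaleDigit_div, hval, ZMod.val_natCast,
    Nat.mod_add_div, Nat.mod_add_div]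

theorem scaleDigit_lt {m : ℕ} [NeZero m] (u : ZMod m) {k n : ℕ} (h : n < m ^ (k + 2)) :
    scaleDigit u n < m ^ (k + 2) := by
  have hm := NeZero.pos m
  rw [pow_succ, pow_succ, ← Nat.div_lt_iff_lt_mul hm, ← Nat.div_lt_iff_lt_mul hm] at h ⊢
  rwa [scaleDigit_div_div]

theorem pM_scaleDigit {m : ℕ} [NeZero m] (u : ZMod m) (k n : ℕ) :
    (pM m (k + 2) (scaleDigit u n) : ZMod m) = u * pM m (k + 2) n := by
  have hm := NeZero.pos m
  rw [pM_succ_mod hm, pM_succ_mod hm, pM_succ hm k, pM_succ hm k, scaleDigit_div_div]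
  push_cast [cast_scaleDigit_div]
  ring

theorem rM_eq_card {m i : ℕ} (hi : i < m) (k : ℕ) :
    rM i m k = ((Finset.range (m ^ k)).filter fun n => (pM m k n : ZMod m) = i).card := by
  rw [rM]
  congr 1
  refine Finset.filter_congr fun n _ => ?_
  rw [ZMod.natCast_eq_natCast_iff, Nat.ModEq, Nat.mod_eq_of_lt hi]

theorem card_pM_eq_unit_mul {m : ℕ} [NeZero m] (u : (ZMod m)ˣ) (c : ZMod m) (k : ℕ) :
    ((Finset.range (m ^ (k + 2))).filter fun n => (pM m (k + 2) n : ZMod m) = u * c).card =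
      ((Finset.range (m ^ (k + 2))).filter fun n => (pM m (k + 2) n : ZMod m) = c).card := by
  refine Finset.card_nbij' (scaleDigit (↑u⁻¹ : ZMod m)) (scaleDigit (u : ZMod m)) ?_ ?_
    (fun n _ => scaleDigit_scaleDigit u.mul_inv n) (fun n _ => scaleDigit_scaleDigit u.inv_mul n)
  · intro n hn
    simp only [Finset.coe_filter, Finset.mem_range, Set.mem_ofPred_eq] at hn ⊢
    exact ⟨scaleDigit_lt _ hn.1, by rw [pM_scaleDigit, hn.2, Units.inv_mul_cancel_left]⟩
  · intro n hn
    simp only [Finset.coe_filter, Finset.mem_range, Set.mem_ofPred_eq] at hn ⊢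
    exact ⟨scaleDigit_lt _ hn.1, by rw [pM_scaleDigit, hn.2]⟩

theorem exists_unit_mul_gcd {m : ℕ} [NeZero m] (i : ℕ) :
    ∃ u : (ZMod m)ˣ, (i : ZMod m) = u * (Nat.gcd i m : ℕ) := by
  obtain ⟨d, hd, v, hv, h⟩ := ZMod.eq_unit_mul_divisor (i : ZMod m)
  obtain ⟨u, rfl⟩ := hv
  refine ⟨u, ?_⟩
  have hmod : i ≡ (u : ZMod m).val * d [MOD m] := by
    rw [← ZMod.natCast_eq_natCast_iff]
    simpa using h
  rw [hmod.gcd_eq, (ZMod.val_coe_unit_coprime u).gcd_mul_left_cancel, Nat.gcd_eq_left hd, h]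

theorem stmt_13 (m k : ℕ) (hm : 2 ≤ m) (hk : 2 ≤ k) (i : ℕ) (hi : i < m) :
    rM i m k = rM (Nat.gcd i m % m) m k := by
  have : NeZero m := ⟨by omega⟩
  obtain ⟨k, rfl⟩ := Nat.exists_eq_add_of_le' hk
  obtain ⟨u, hu⟩ := exists_unit_mul_gcd (m := m) i
  rw [rM_eq_card hi, rM_eq_card (Nat.mod_lt _ (by omega)), hu, card_pM_eq_unit_mul,
    ZMod.natCast_mod]
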